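/- arXiv:1012.5493 — 5 statements merged into one kernel-verified Lean document; each statement's English description precedes it below -/
import Mathlib

section
/- Let F = F_{α,φ} be an Anzai skew product with α irrational, ∫_{ℝ/ℤ} φ(x) dx = 0, and φ absolutely continuous. Then every point of (ℝ/ℤ)×ℝ is recurrent under F: for every (x,y) there is a sequence of positive integers n_k → ∞ with F^{n_k}(x,y) → (x,y). Equivalently, 0 ∈ 𝓛_x for every x ∈ ℝ/ℤ; in particular 𝓛_x is nonempty. -/
open Filter Topology MeasureTheory

noncomputable section

/-- The Anzai skew product `F(x,y) = (x+α, y+φ(x))` on `(ℝ/ℤ) × ℝ`, as a bijection. -/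
def anzai (α : ℝ) (φ : AddCircle (1 : ℝ) → ℝ) : Equiv.Perm (AddCircle (1 : ℝ) × ℝ) where
  toFun z := (z.1 + (α : AddCircle (1 : ℝ)), z.2 + φ z.1)
  invFun z := (z.1 - (α : AddCircle (1 : ℝ)), z.2 - φ (z.1 - (α : AddCircle (1 : ℝ))))
  left_inv z := by simp
  right_inv z := by simp

/-- The limit set `λ(z)` of a point `z` under the Anzai skew product: all limits of sequences
`F^{n_k}(z)` with `|n_k| → ∞` (the union of the α-limit and ω-limit sets). -/
def limitSet (α : ℝ) (φ : AddCircle (1 : ℝ) → ℝ) (z : AddCircle (1 : ℝ) × ℝ) :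
    Set (AddCircle (1 : ℝ) × ℝ) :=
  {w | ∃ n : ℕ → ℤ, Tendsto (fun k => |n k|) atTop atTop ∧
    Tendsto (fun k => ((anzai α φ) ^ (n k)) z) atTop (𝓝 w)}

/-- Poincaré's set `𝓛_x = { y ∈ ℝ : (x,y) ∈ λ(x,0) }`. -/
def Lx (α : ℝ) (φ : AddCircle (1 : ℝ) → ℝ) (x : AddCircle (1 : ℝ)) : Set ℝ :=
  {y | ((x, y) : AddCircle (1 : ℝ) × ℝ) ∈ limitSet α φ (x, 0)}

/-- `φ : ℝ/ℤ → ℝ` is absolutely continuous: there is `g ∈ L¹` with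
`φ(x) − φ(0) = ∫₀ˣ g(t) dt` for all `x ∈ [0,1]`. -/
def AbsolutelyContinuous' (φ : AddCircle (1 : ℝ) → ℝ) : Prop :=
  ∃ g : ℝ → ℝ, IntegrableOn g (Set.Icc 0 1) ∧
    ∀ x ∈ Set.Icc (0 : ℝ) 1, φ (x : ℝ) - φ ((0 : ℝ) : AddCircle (1 : ℝ)) = ∫ t in (0 : ℝ)..x, g t

/-- Conditions (3.1)–(3.4): `α` irrational, `φ` continuous with zero mean, the cohomological
equation `h ∘ R_α − h = φ` has no continuous solution, and `φ` is absolutely continuous. -/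
def AnzaiConds (α : ℝ) (φ : AddCircle (1 : ℝ) → ℝ) : Prop :=
  Irrational α ∧ Continuous φ ∧ (∫ x : AddCircle (1 : ℝ), φ x = 0) ∧
  (¬ ∃ h : AddCircle (1 : ℝ) → ℝ, Continuous h ∧
      ∀ x, h (x + (α : AddCircle (1 : ℝ))) - h x = φ x) ∧
  AbsolutelyContinuous' φ

section Permutation

/-- Multiplication by an integer coprime to `q` permutes the residues modulo `q`. -/
theorem sum_range_mul_of_periodic {E : Type*} [AddCommMonoid E] {q : ℕ} (hq : 0 < q) {p : ℤ}
    (hpq : IsCoprime p (q : ℤ)) {K : ℤ → E} (hK : Function.Periodic K (q : ℤ)) :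
    ∑ i ∈ Finset.range q, K (i * p) = ∑ i ∈ Finset.range q, K i := by
  have hq' : (0 : ℤ) < q := by exact_mod_cast hq
  have hcast (i : ℕ) : (((i * p % q : ℤ).toNat : ℕ) : ℤ) = i * p % q :=
    Int.toNat_of_nonneg (Int.emod_nonneg _ hq'.ne')
  have hmaps : Set.MapsTo (fun i : ℕ => (i * p % q : ℤ).toNat) (Finset.range q)
      (Finset.range q) := by
    intro i _
    have := Int.emod_lt_of_pos (i * p) hq'
    simp only [Finset.coe_range, Set.mem_Iio]
    have := hcast i
    omega
  have hinj : Set.InjOn (fun i : ℕ => (i * p % q : ℤ).toNat) (Finset.range q) := by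
    intro i hi j hj hij
    simp only [Finset.coe_range, Set.mem_Iio] at hi hj
    have h : (i * p : ℤ) % q = j * p % q := by
      rw [← hcast i, ← hcast j]
      exact_mod_cast hij
    have hdvd : (q : ℤ) ∣ (j - i) * p := by
      rw [sub_mul]
      exact Int.ModEq.dvd h
    obtain ⟨c, hc⟩ := hpq.symm.dvd_of_dvd_mul_right hdvd
    have h0 : (q : ℤ) ∣ (j - i : ℤ) := ⟨c, hc⟩
    have := Int.eq_zero_of_abs_lt_dvd h0 (by rw [abs_lt]; constructor <;> omega)
    omega
  refine Finset.sum_nbij (fun i => (i * p % q : ℤ).toNat) hmaps hinj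
    (Finset.surjOn_of_injOn_of_card_le _ hmaps hinj le_rfl) fun i _ => ?_
  rw [hcast]
  conv_lhs => rw [← Int.emod_add_mul_ediv (i * p) q, mul_comm (q : ℤ)]
  exact hK.int_mul _ _

end Permutation

section CircleIntegral

variable {E : Type*} [NormedAddCommGroup E]

theorem MeasureTheory.Integrable.intervalIntegrable_coe_addCircle
    {G : AddCircle (1 : ℝ) → E} (hG : Integrable G) (a b : ℝ) :
    IntervalIntegrable (fun t : ℝ => G t) volume a b := by
  have hper : Function.Periodic (fun t : ℝ => G t) 1 := fun t => by
    simp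
  refine hper.intervalIntegrable (t := 0) one_ne_zero ?_ a b
  rw [intervalIntegrable_iff_integrableOn_Ioc_of_le (by norm_num)]
  exact (AddCircle.measurePreserving_mk (1 : ℝ) 0).integrable_comp_of_integrable hG

variable [NormedSpace ℝ E]

/-- The arcs of length `1 / q` starting at the points `x + i p / q` tile the circle. -/
theorem sum_integral_arcs {G : AddCircle (1 : ℝ) → E} (hG : Integrable G) (x : ℝ) {q : ℕ}
    (hq : 0 < q) {p : ℤ} (hpq : IsCoprime p (q : ℤ)) :
    ∑ i ∈ Finset.range q, ∫ t in (x + i * p / q)..(x + i * p / q + 1 / q), G (t : ℝ) =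
      ∫ t, G t := by
  have hq' : (q : ℝ) ≠ 0 := by positivity
  have hper : Function.Periodic
      (fun m : ℤ => ∫ t in (x + m / q)..(x + m / q + 1 / q), G (t : ℝ)) (q : ℤ) := by
    intro m
    have h1 : x + ((m + q : ℤ) : ℝ) / q = x + m / q + 1 := by
      push_cast
      field_simp
      ring
    simp only [h1]
    rw [show x + m / q + 1 + 1 / (q : ℝ) = x + m / q + 1 / q + 1 by ring,
      ← intervalIntegral.integral_comp_add_right (fun t : ℝ => G t) 1]
    simp
  have hsum := sum_range_mul_of_periodic hq hpq hper
  push_cast at hsum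
  rw [hsum]
  have hadj := intervalIntegral.sum_integral_adjacent_intervals (μ := volume)
    (f := fun t : ℝ => G t) (a := fun k : ℕ => x + k / q) (n := q)
    fun k _ => hG.intervalIntegrable_coe_addCircle _ _
  rw [← AddCircle.intervalIntegral_preimage 1 x]
  simp only [Nat.cast_zero, zero_div, add_zero, div_self hq'] at hadj
  rw [← hadj]
  refine Finset.sum_congr rfl fun k _ => ?_
  congr 1
  push_cast
  ring

end CircleIntegral

/-- `G` is an integrable derivative of `f`, in the sense of absolute continuity. -/
def HasIntegrableDeriv (f G : AddCircle (1 : ℝ) → ℂ) : Prop :=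
  Integrable G ∧ ∀ a b : ℝ, f b - f a = ∫ t in a..b, G (t : ℝ)

namespace HasIntegrableDeriv

variable {f G f' G' : AddCircle (1 : ℝ) → ℂ}

theorem add (h : HasIntegrableDeriv f G) (h' : HasIntegrableDeriv f' G') :
    HasIntegrableDeriv (fun x => f x + f' x) (fun x => G x + G' x) := by
  refine ⟨h.1.add h'.1, fun a b => ?_⟩
  rw [intervalIntegral.integral_add (h.1.intervalIntegrable_coe_addCircle a b)
    (h'.1.intervalIntegrable_coe_addCircle a b), ← h.2, ← h'.2]
  ring

theorem const_mul (c : ℂ) (h : HasIntegrableDeriv f G) :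
    HasIntegrableDeriv (fun x => c * f x) (fun x => c * G x) := by
  refine ⟨h.1.const_mul c, fun a b => ?_⟩
  rw [intervalIntegral.integral_const_mul, ← h.2]
  ring

theorem sub (h : HasIntegrableDeriv f G) (h' : HasIntegrableDeriv f' G') :
    HasIntegrableDeriv (fun x => f x - f' x) (fun x => G x - G' x) := by
  simpa [sub_eq_add_neg] using h.add (h'.const_mul (-1))

theorem integral_eq_zero (h : HasIntegrableDeriv f G) : ∫ x, G x = 0 := by
  rw [← AddCircle.intervalIntegral_preimage 1 0, ← h.2]
  simp [AddCircle.coe_period]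

/-- The **Denjoy–Koksma inequality** for absolutely continuous functions. -/
theorem norm_birkhoffSum_le (h : HasIntegrableDeriv f G) (hf : Continuous f)
    (hint : ∫ x, f x = 0) {α : ℝ} {q : ℕ} (hq : 0 < q) {p : ℤ} (hpq : IsCoprime p (q : ℤ))
    (hα : |α - p / q| ≤ 1 / (q : ℝ) ^ 2) (x : ℝ) :
    ‖∑ i ∈ Finset.range q, f ((x + i * α : ℝ) : AddCircle (1 : ℝ))‖ ≤ ∫ t, ‖G t‖ := by
  have hq' : (0 : ℝ) < q := by exact_mod_cast hq
  obtain ⟨y, hy⟩ : ∃ y : ℝ, ∀ i ∈ Finset.range q,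
      x + i * α ∈ Set.Icc (y + i * p / q) (y + i * p / q + 1 / q) := by
    have hoff : ∀ i ∈ Finset.range q, |i * (α - p / q)| ≤ 1 / (q : ℝ) := by
      intro i hi
      have hi' : (i : ℝ) ≤ q := by exact_mod_cast (Finset.mem_range.mp hi).le
      rw [abs_mul, Nat.abs_cast]
      calc (i : ℝ) * |α - p / q| ≤ q * (1 / (q : ℝ) ^ 2) := by gcongr
        _ = 1 / q := by field_simp
    rcases le_total ((p : ℝ) / q) α with hle | hle
    · refine ⟨x, fun i hi => ?_⟩
      have h1 := (abs_le.mp (hoff i hi)).2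
      have h2 : 0 ≤ i * (α - p / q) := mul_nonneg (by positivity) (by linarith)
      have h3 : (i : ℝ) * p / q = i * (p / q) := by ring
      constructor <;> linarith
    · refine ⟨x - 1 / q, fun i hi => ?_⟩
      have h1 := (abs_le.mp (hoff i hi)).1
      have h2 : i * (α - p / q) ≤ 0 := mul_nonpos_of_nonneg_of_nonpos (by positivity) (by linarith)
      have h3 : (i : ℝ) * p / q = i * (p / q) := by ring
      constructor <;> linarith
  have hfi : Integrable f := hf.integrable_of_hasCompactSupport (.of_compactSpace f)
  have hlocal : ∀ i ∈ Finset.range q,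
      ‖f ((x + i * α : ℝ) : AddCircle (1 : ℝ)) -
        q * ∫ t in (y + i * p / q)..(y + i * p / q + 1 / q), f (t : ℝ)‖ ≤
      ∫ t in (y + i * p / q)..(y + i * p / q + 1 / q), ‖G (t : ℝ)‖ := by
    intro i hi
    have hyi := hy i hi
    generalize x + i * α = s at hyi ⊢
    generalize y + i * p / q = a at hyi ⊢
    have hab : a ≤ a + 1 / (q : ℝ) := by linarith [hyi.1, hyi.2]
    have hvar : ∀ t ∈ Set.uIoc a (a + 1 / (q : ℝ)),
        ‖f (s : ℝ) - f (t : ℝ)‖ ≤ ∫ t in a..(a + 1 / q), ‖G (t : ℝ)‖ := by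
      intro t ht
      rw [Set.uIoc_of_le hab] at ht
      rw [h.2 t s]
      refine intervalIntegral.norm_integral_le_integral_norm_uIoc.trans ?_
      rw [intervalIntegral.integral_of_le hab]
      refine setIntegral_mono_set ?_ (ae_of_all _ fun t => norm_nonneg _) ?_
      · exact ((h.1.intervalIntegrable_coe_addCircle a (a + 1 / q)).norm).1
      · refine LE.le.eventuallyLE ?_
        exact Set.Ioc_subset_Ioc (le_min ht.1.le hyi.1) (max_le ht.2 hyi.2)
    have hdiff : f (s : ℝ) - q * ∫ t in a..(a + 1 / q), f (t : ℝ) =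
        q * ∫ t in a..(a + 1 / q), (f (s : ℝ) - f (t : ℝ)) := by
      rw [intervalIntegral.integral_sub (by simp) (hfi.intervalIntegrable_coe_addCircle _ _),
        intervalIntegral.integral_const, mul_sub]
      congr 1
      have : (q : ℂ) ≠ 0 := by exact_mod_cast hq.ne'
      simp [this]
    rw [hdiff, norm_mul]
    have := intervalIntegral.norm_integral_le_of_norm_le_const hvar
    rw [add_sub_cancel_left, abs_of_nonneg (by positivity)] at this
    calc _ ≤ (q : ℝ) * ((∫ t in a..(a + 1 / q), ‖G (t : ℝ)‖) * (1 / q)) := by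
          simp only [Complex.norm_natCast]
          gcongr
      _ = _ := by field_simp
  have hmean : ∑ i ∈ Finset.range q,
      (q : ℂ) * ∫ t in (y + i * p / q)..(y + i * p / q + 1 / q), f (t : ℝ) = 0 := by
    rw [← Finset.mul_sum, sum_integral_arcs hfi y hq hpq, hint, mul_zero]
  rw [← sum_integral_arcs h.1.norm y hq hpq, ← sub_zero (∑ i ∈ _, f _), ← hmean,
    ← Finset.sum_sub_distrib]
  exact norm_sum_le_of_le _ hlocal

end HasIntegrableDeriv

theorem fourier_coe_ne_one_of_irrational {α : ℝ} (hα : Irrational α) {n : ℤ} (hn : n ≠ 0) :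
    fourier n (α : AddCircle (1 : ℝ)) ≠ 1 := by
  rw [fourier_coe_apply, Ne, Complex.exp_eq_one_iff]
  rintro ⟨m, hm⟩
  have hpi : (2 * Real.pi * Complex.I : ℂ) ≠ 0 := Complex.two_pi_I_ne_zero
  have h : (n * α : ℂ) = m := by
    refine mul_left_cancel₀ hpi ?_
    rw [mul_comm _ (m : ℂ), ← hm]
    push_cast
    ring
  have h' : (n * α : ℝ) = m := by exact_mod_cast h
  exact (hα.intCast_mul hn).ne_int m h'

/-- Up to a constant, a trigonometric polynomial is the derivative of a continuous coboundary of
an irrational rotation. -/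
theorem exists_coboundary_of_mem_span_fourier {α : ℝ} (hα : Irrational α)
    {h : C(AddCircle (1 : ℝ), ℂ)} (hh : h ∈ Submodule.span ℂ (Set.range (@fourier (1 : ℝ)))) :
    ∃ (c : ℂ) (u : AddCircle (1 : ℝ) → ℂ), Continuous u ∧
      HasIntegrableDeriv (fun x => u (x + (α : AddCircle (1 : ℝ))) - u x)
        (fun x => h x - c) := by
  induction hh using Submodule.span_induction with
  | mem h hmem =>
    obtain ⟨n, rfl⟩ := hmem
    rcases eq_or_ne n 0 with rfl | hn
    · exact ⟨1, fun _ => 0, continuous_const, by simp [HasIntegrableDeriv]⟩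
    · set d : ℂ := 2 * Real.pi * Complex.I * n with hd
      have hd0 : d ≠ 0 := mul_ne_zero Complex.two_pi_I_ne_zero (by exact_mod_cast hn)
      have he : fourier n (α : AddCircle (1 : ℝ)) - 1 ≠ 0 :=
        sub_ne_zero.mpr (fourier_coe_ne_one_of_irrational hα hn)
      refine ⟨0, fun x => d⁻¹ * (fourier n (α : AddCircle (1 : ℝ)) - 1)⁻¹ * fourier n x,
        by fun_prop, ?_⟩
      have hcob : (fun x : AddCircle (1 : ℝ) =>
          d⁻¹ * (fourier n (α : AddCircle (1 : ℝ)) - 1)⁻¹ *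
            fourier n (x + (α : AddCircle (1 : ℝ))) -
          d⁻¹ * (fourier n (α : AddCircle (1 : ℝ)) - 1)⁻¹ * fourier n x) =
          fun x => d⁻¹ * fourier n x := by
        funext x
        have hadd : fourier n (x + (α : AddCircle (1 : ℝ))) =
            fourier n x * fourier n (α : AddCircle (1 : ℝ)) := by
          simp [fourier_apply, smul_add, AddCircle.toCircle_add]
        rw [hadd]
        field_simp
      simp only [hcob, sub_zero]
      refine ⟨(fourier n).continuous.integrable_of_hasCompactSupport (.of_compactSpace _),
        fun a b => ?_⟩
      refine (intervalIntegral.integral_eq_sub_of_hasDerivAt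
        (f := fun t : ℝ => d⁻¹ * fourier n (t : AddCircle (1 : ℝ))) (fun t _ => ?_) ?_).symm
      · have := (hasDerivAt_fourier 1 n t).const_mul d⁻¹
        simpa [← hd, hd0] using this
      · exact Continuous.intervalIntegrable
          ((fourier n).continuous.comp (AddCircle.continuous_mk' 1)) _ _
  | zero => exact ⟨0, fun _ => 0, continuous_const, by simp [HasIntegrableDeriv]⟩
  | add h₁ h₂ _ _ ih₁ ih₂ =>
    obtain ⟨c₁, u₁, hu₁, hd₁⟩ := ih₁
    obtain ⟨c₂, u₂, hu₂, hd₂⟩ := ih₂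
    refine ⟨c₁ + c₂, fun x => u₁ x + u₂ x, by fun_prop, ?_⟩
    convert hd₁.add hd₂ using 2
    · ring
    · simp only [ContinuousMap.add_apply]
      ring
  | smul a h _ ih =>
    obtain ⟨c, u, hu, hd⟩ := ih
    refine ⟨a * c, fun x => a * u x, by fun_prop, ?_⟩
    convert hd.const_mul a using 2
    · ring
    · simp only [ContinuousMap.smul_apply, smul_eq_mul]
      ring

/-- Trigonometric polynomials are dense in `L¹` of the circle. -/
theorem exists_mem_span_fourier_integral_norm_sub_le {G : AddCircle (1 : ℝ) → ℂ}
    (hG : Integrable G) {ε : ℝ} (hε : 0 < ε) :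
    ∃ h ∈ Submodule.span ℂ (Set.range (@fourier (1 : ℝ))), ∫ x, ‖G x - h x‖ ≤ ε := by
  obtain ⟨k, -, hk, hkc, hki⟩ := hG.exists_hasCompactSupport_integral_sub_le (half_pos hε)
  have hmem : (⟨k, hkc⟩ : C(AddCircle (1 : ℝ), ℂ)) ∈
      (Submodule.span ℂ (Set.range (@fourier (1 : ℝ)))).topologicalClosure := by
    rw [span_fourier_closure_eq_top]
    trivial
  obtain ⟨h, hh, hdist⟩ := Metric.mem_closure_iff.mp hmem (ε / 2) (half_pos hε)
  have hhi : Integrable h := h.continuous.integrable_of_hasCompactSupport (.of_compactSpace _)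
  refine ⟨h, hh, ?_⟩
  calc ∫ x, ‖G x - h x‖ ≤ ∫ x, (‖G x - k x‖ + ε / 2) := by
        refine integral_mono (hG.sub hhi).norm ((hG.sub hki).norm.add (integrable_const _))
          fun x => ?_
        have := (ContinuousMap.dist_apply_le_dist (f := ⟨k, hkc⟩) (g := h) x).trans hdist.le
        rw [dist_eq_norm] at this
        simpa using (norm_sub_le_norm_sub_add_norm_sub (G x) (k x) (h x)).trans
          (add_le_add_right this _)
    _ = (∫ x, ‖G x - k x‖) + ε / 2 := by
        rw [integral_add (f := fun x => ‖G x - k x‖) (hG.sub hki).norm (integrable_const _)]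
        simp [Measure.real]
    _ ≤ ε := by linarith

/-- An absolutely continuous function on the circle is approximated in variation by continuous
coboundaries of an irrational rotation. -/
theorem HasIntegrableDeriv.exists_coboundary {α : ℝ} (hα : Irrational α)
    {f G : AddCircle (1 : ℝ) → ℂ} (h : HasIntegrableDeriv f G) {ε : ℝ} (hε : 0 < ε) :
    ∃ u G' : AddCircle (1 : ℝ) → ℂ, Continuous u ∧
      HasIntegrableDeriv (fun x => f x - (u (x + (α : AddCircle (1 : ℝ))) - u x)) G' ∧
      ∫ x, ‖G' x‖ ≤ ε := by
  obtain ⟨k, hk, hGk⟩ := exists_mem_span_fourier_integral_norm_sub_le h.1 (half_pos hε)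
  obtain ⟨c, u, hu, hd⟩ := exists_coboundary_of_mem_span_fourier hα hk
  have hki : Integrable k := k.continuous.integrable_of_hasCompactSupport (.of_compactSpace _)
  refine ⟨u, _, hu, h.sub hd, ?_⟩
  have hc : c = -∫ x, (G x - k x) := by
    have h1 := hd.integral_eq_zero
    rw [integral_sub hki (integrable_const c)] at h1
    rw [integral_sub h.1 hki, h.integral_eq_zero]
    simpa [Measure.real] using (sub_eq_zero.mp h1).symm
  have hcn : ‖c‖ ≤ ε / 2 := by
    rw [hc, norm_neg]
    exact (norm_integral_le_integral_norm _).trans hGk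
  calc ∫ x, ‖G x - (k x - c)‖ ≤ ∫ x, (‖G x - k x‖ + ‖c‖) := by
        refine integral_mono (h.1.sub hd.1).norm ((h.1.sub hki).norm.add (integrable_const _))
          fun x => ?_
        rw [← sub_add]
        exact norm_add_le _ _
    _ = (∫ x, ‖G x - k x‖) + ‖c‖ := by
        rw [integral_add (f := fun x => ‖G x - k x‖) (h.1.sub hki).norm (integrable_const _)]
        simp [Measure.real]
    _ ≤ ε := by linarith

/-- An irrational number has coprime rational approximations of quality `1 / q ^ 2` with
arbitrarily large denominator `q`. -/
theorem Irrational.exists_rat_abs_sub_lt_le_den {α : ℝ} (hα : Irrational α) (N : ℕ) :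
    ∃ r : ℚ, |α - r| < 1 / (r.den : ℝ) ^ 2 ∧ N ≤ r.den := by
  by_contra! hcon
  refine Real.infinite_rat_abs_sub_lt_one_div_den_sq_of_irrational hα ?_
  obtain ⟨M, hM⟩ := exists_nat_ge ((|α| + 1) * N)
  refine Set.Finite.of_finite_image (f := fun r : ℚ => (r.num, r.den)) ?_ ?_
  · refine ((Set.finite_Icc (-(M : ℤ)) M).prod (Set.finite_Iio N)).subset ?_
    rintro _ ⟨r, hr, rfl⟩
    have hden := hcon r hr
    have hpos : (0 : ℝ) < r.den := by exact_mod_cast r.pos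
    have hone : (1 : ℝ) ≤ r.den := by exact_mod_cast r.pos
    have hr1 : |(r : ℝ)| ≤ |α| + 1 := by
      have h1 : |α - r| < 1 := lt_of_lt_of_le hr (by
        rw [div_le_one (by positivity)]
        exact one_le_pow₀ hone)
      have h2 := abs_sub_abs_le_abs_sub (r : ℝ) α
      rw [abs_sub_comm] at h2
      linarith
    have hnum : |(r.num : ℝ)| ≤ M := by
      have h3 : (r.num : ℝ) = r * r.den := by exact_mod_cast (Rat.mul_den_eq_num r).symm
      rw [h3, abs_mul, abs_of_pos hpos]
      refine le_trans ?_ hM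
      gcongr
    have hnum' : |r.num| ≤ (M : ℤ) := by exact_mod_cast hnum
    exact ⟨abs_le.mp hnum', hden⟩
  · intro r _ s _ hrs
    simp only [Prod.mk.injEq] at hrs
    exact Rat.ext hrs.1 hrs.2

/-- Along denominators of good rational approximations, the Birkhoff sums of an absolutely
continuous function of zero mean over an irrational rotation become small. -/
theorem HasIntegrableDeriv.exists_norm_birkhoffSum_lt {α : ℝ} (hα : Irrational α)
    {f G : AddCircle (1 : ℝ) → ℂ} (h : HasIntegrableDeriv f G) (hf : Continuous f)
    (hint : ∫ x, f x = 0) (x : ℝ) {ε : ℝ} (hε : 0 < ε) (N : ℕ) :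
    ∃ q : ℕ, N ≤ q ∧ ‖((q * α : ℝ) : AddCircle (1 : ℝ))‖ < ε ∧
      ‖∑ i ∈ Finset.range q, f ((x + i * α : ℝ) : AddCircle (1 : ℝ))‖ < ε := by
  obtain ⟨u, G', hu, hd, hG'⟩ := h.exists_coboundary hα (half_pos hε)
  obtain ⟨δ, hδ, huδ⟩ := Metric.continuous_iff.mp hu (x : AddCircle (1 : ℝ)) (ε / 2) (half_pos hε)
  obtain ⟨M, hM⟩ := exists_nat_gt (1 / min δ ε)
  obtain ⟨r, hr, hden⟩ := hα.exists_rat_abs_sub_lt_le_den (max N M)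
  have hpos : (0 : ℝ) < r.den := by exact_mod_cast r.pos
  have hcast : (r : ℝ) = r.num / r.den := Rat.cast_def r
  have hrot : ‖((r.den * α : ℝ) : AddCircle (1 : ℝ))‖ < min δ ε := by
    have h1 : ‖((r.den * α : ℝ) : AddCircle (1 : ℝ))‖ ≤ |r.den * α - r.num| := by
      rw [UnitAddCircle.norm_eq]
      exact round_le _ _
    refine h1.trans_lt ?_
    have h2 : (r.den : ℝ) * α - r.num = r.den * (α - r) := by
      rw [hcast]
      field_simp
    have h3 : 1 / min δ ε < r.den :=
      hM.trans_le (by exact_mod_cast (le_max_right N M).trans hden)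
    rw [h2, abs_mul, abs_of_pos hpos]
    calc (r.den : ℝ) * |α - r| < r.den * (1 / (r.den : ℝ) ^ 2) := by gcongr
      _ = 1 / r.den := by field_simp
      _ < min δ ε := by
        rw [one_div_lt hpos (lt_min hδ hε)]
        exact h3
  refine ⟨r.den, (le_max_left N M).trans hden, hrot.trans_le (min_le_right _ _), ?_⟩
  have hui : Integrable u := hu.integrable_of_hasCompactSupport (.of_compactSpace _)
  have hfi : Integrable f := hf.integrable_of_hasCompactSupport (.of_compactSpace _)
  have hmean : ∫ x, (f x - (u (x + (α : AddCircle (1 : ℝ))) - u x)) = 0 := by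
    have huα := hui.comp_add_right (α : AddCircle (1 : ℝ))
    rw [integral_sub (g := fun x => u (x + (α : AddCircle (1 : ℝ))) - u x) hfi (huα.sub hui),
      integral_sub huα hui, integral_add_right_eq_self, hint]
    simp
  have hDK := hd.norm_birkhoffSum_le (by fun_prop) hmean r.pos
    (Int.isCoprime_iff_nat_coprime.mpr (by simpa using r.reduced)) (by rw [← hcast]; exact hr.le) x
  have htel : ∑ i ∈ Finset.range r.den, f ((x + i * α : ℝ) : AddCircle (1 : ℝ)) =
      ∑ i ∈ Finset.range r.den, (f ((x + i * α : ℝ) : AddCircle (1 : ℝ)) -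
        (u (((x + i * α : ℝ) : AddCircle (1 : ℝ)) + (α : AddCircle (1 : ℝ))) -
          u ((x + i * α : ℝ) : AddCircle (1 : ℝ)))) +
      (u ((x + r.den * α : ℝ) : AddCircle (1 : ℝ)) - u (x : AddCircle (1 : ℝ))) := by
    have hs := Finset.sum_range_sub
      (fun i : ℕ => u ((x + i * α : ℝ) : AddCircle (1 : ℝ))) r.den
    simp only [Nat.cast_zero, zero_mul, add_zero] at hs
    rw [← hs, ← Finset.sum_add_distrib]
    refine Finset.sum_congr rfl fun i _ => ?_
    have : (((x + i * α : ℝ) : AddCircle (1 : ℝ)) + (α : AddCircle (1 : ℝ))) =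
        ((x + (i + 1 : ℕ) * α : ℝ) : AddCircle (1 : ℝ)) := by
      rw [← AddCircle.coe_add]
      congr 1
      push_cast
      ring
    rw [this]
    ring
  have hu' : ‖u ((x + r.den * α : ℝ) : AddCircle (1 : ℝ)) - u (x : AddCircle (1 : ℝ))‖ <
      ε / 2 := by
    rw [← dist_eq_norm]
    refine huδ _ ?_
    rw [AddCircle.coe_add, dist_eq_norm, add_sub_cancel_left]
    exact hrot.trans_le (min_le_left _ _)
  rw [htel]
  refine (norm_add_le _ _).trans_lt ?_
  linarith

/-- The primitive description of absolute continuity on `[0, 1]` extends to all intervals. -/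
theorem AbsolutelyContinuous'.exists_hasIntegrableDeriv {φ : AddCircle (1 : ℝ) → ℝ}
    (hφ : AbsolutelyContinuous' φ) :
    ∃ G, HasIntegrableDeriv (fun x => (φ x : ℂ)) G := by
  obtain ⟨g, hg, hgφ⟩ := hφ
  set G : AddCircle (1 : ℝ) → ℂ := AddCircle.liftIoc 1 0 (fun t => (g t : ℂ)) with hGdef
  have hG : Integrable G := by
    rw [← memLp_one_iff_integrable]
    refine MemLp.memLp_liftIoc ?_
    rw [memLp_one_iff_integrable]
    refine Integrable.ofReal ?_
    rw [zero_add]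
    exact hg.mono_set Set.Ioc_subset_Icc_self
  have hprim : ∀ x ∈ Set.Icc (0 : ℝ) 1,
      (φ (x : ℝ) : ℂ) - φ ((0 : ℝ) : AddCircle (1 : ℝ)) = ∫ t in (0 : ℝ)..x, G (t : ℝ) := by
    intro x hx
    rw [← Complex.ofReal_sub, hgφ x hx, ← intervalIntegral.integral_ofReal]
    refine intervalIntegral.integral_congr_ae (.of_forall fun t ht => ?_)
    rw [Set.uIoc_of_le hx.1] at ht
    rw [hGdef, AddCircle.liftIoc_coe_apply ⟨ht.1, by linarith [ht.2, hx.2]⟩]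
  have hper : Function.Periodic (fun t : ℝ => G t) 1 := fun t => by simp
  have hφper : Function.Periodic (fun t : ℝ => φ t) 1 := fun t => by simp
  have hzero : ∫ t in (0 : ℝ)..1, G (t : ℝ) = 0 := by
    rw [← hprim 1 (by simp)]
    simp [AddCircle.coe_period]
  have hall : ∀ x : ℝ,
      (φ (x : ℝ) : ℂ) - φ ((0 : ℝ) : AddCircle (1 : ℝ)) = ∫ t in (0 : ℝ)..x, G (t : ℝ) := by
    have hP : Function.Periodic (fun x : ℝ => ∫ t in (0 : ℝ)..x, G (t : ℝ)) 1 := by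
      intro x
      have := hper.intervalIntegral_add_eq x 0
      simp only
      rw [← intervalIntegral.integral_add_adjacent_intervals
        (hG.intervalIntegrable_coe_addCircle 0 x)
        (hG.intervalIntegrable_coe_addCircle x (x + 1)), this, zero_add, hzero, add_zero]
    intro x
    have h1 := hprim (Int.fract x) ⟨Int.fract_nonneg x, (Int.fract_lt_one x).le⟩
    have h2 := hP.sub_int_mul_eq (x := x) ⌊x⌋
    have h3 := hφper.sub_int_mul_eq (x := x) ⌊x⌋
    simp only [mul_one, Int.self_sub_floor] at h2 h3
    rw [← h2, ← h1, h3]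
  refine ⟨G, hG, fun a b => ?_⟩
  rw [← intervalIntegral.integral_interval_sub_left (hG.intervalIntegrable_coe_addCircle 0 b)
    (hG.intervalIntegrable_coe_addCircle 0 a), ← hall, ← hall]
  ring

theorem anzai_pow_apply (α : ℝ) (φ : AddCircle (1 : ℝ) → ℝ) (n : ℕ) (x y : ℝ) :
    ((anzai α φ) ^ n) ((x : AddCircle (1 : ℝ)), y) =
      (((x + n * α : ℝ) : AddCircle (1 : ℝ)),
        y + ∑ i ∈ Finset.range n, φ ((x + i * α : ℝ) : AddCircle (1 : ℝ))) := by
  induction n with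
  | zero => simp
  | succ n ih =>
    rw [pow_succ', Equiv.Perm.mul_apply, ih, Finset.sum_range_succ]
    refine Prod.ext ?_ ?_
    · change ((x + n * α : ℝ) : AddCircle (1 : ℝ)) + (α : AddCircle (1 : ℝ)) = _
      rw [← AddCircle.coe_add]
      push_cast
      ring_nf
    · exact add_assoc _ _ _

/-- Every point of `(ℝ/ℤ) × ℝ` is recurrent under the Anzai skew product; equivalently
`0 ∈ 𝓛_x` for every `x`. -/
theorem stmt_10 (α : ℝ) (hα : Irrational α) (φ : AddCircle (1 : ℝ) → ℝ)
    (hφcont : Continuous φ) (hφint : ∫ x : AddCircle (1 : ℝ), φ x = 0)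
    (hφac : AbsolutelyContinuous' φ) :
    (∀ z : AddCircle (1 : ℝ) × ℝ, ∃ n : ℕ → ℕ, (∀ k, 0 < n k) ∧
      Tendsto n atTop atTop ∧
      Tendsto (fun k => ((anzai α φ) ^ (n k : ℤ)) z) atTop (𝓝 z)) ∧
    (∀ x : AddCircle (1 : ℝ), (0 : ℝ) ∈ Lx α φ x) := by
  obtain ⟨G, hG⟩ := hφac.exists_hasIntegrableDeriv
  have hrec : ∀ z : AddCircle (1 : ℝ) × ℝ, ∃ n : ℕ → ℕ, (∀ k, 0 < n k) ∧
      Tendsto n atTop atTop ∧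
      Tendsto (fun k => ((anzai α φ) ^ (n k : ℤ)) z) atTop (𝓝 z) := by
    rintro ⟨x, y⟩
    obtain ⟨x, rfl⟩ := QuotientAddGroup.mk_surjective x
    have hint : ∫ x, (φ x : ℂ) = 0 := by
      rw [integral_complex_ofReal, hφint, Complex.ofReal_zero]
    choose n hn hrot hsum using fun k : ℕ =>
      hG.exists_norm_birkhoffSum_lt hα (by fun_prop) hint x
        (Nat.one_div_pos_of_nat (α := ℝ) (n := k)) (k + 1)
    refine ⟨n, fun k => by linarith [hn k], tendsto_atTop_mono
      (fun k => (Nat.le_succ k).trans (hn k)) tendsto_id, ?_⟩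
    have hlim := tendsto_one_div_add_atTop_nhds_zero_nat (𝕜 := ℝ)
    have h1 : Tendsto (fun k => ((n k * α : ℝ) : AddCircle (1 : ℝ))) atTop (𝓝 0) :=
      squeeze_zero_norm (fun k => (hrot k).le) hlim
    have h2 : Tendsto
        (fun k => ∑ i ∈ Finset.range (n k), φ ((x + i * α : ℝ) : AddCircle (1 : ℝ)))
        atTop (𝓝 0) := by
      refine squeeze_zero_norm (fun k => ?_) hlim
      have := (hsum k).le
      rwa [← Complex.ofReal_sum, Complex.norm_real] at this
    have h3 := (h1.const_add (x : AddCircle (1 : ℝ))).prodMk_nhds (h2.const_add y)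
    rw [add_zero, add_zero] at h3
    refine h3.congr fun k => ?_
    rw [zpow_natCast]
    exact (anzai_pow_apply α φ (n k) x y).symm
  refine ⟨hrec, fun x => ?_⟩
  obtain ⟨n, -, hn, hlim⟩ := hrec (x, 0)
  refine ⟨fun k => n k, ?_, hlim⟩
  simpa [Function.comp_def] using (tendsto_natCast_atTop_atTop.comp hn :
    Tendsto (fun k => (n k : ℤ)) atTop atTop)
end
end

section
/- Let F = F_{α,φ} be an Anzai skew product (α ∈ ℝ arbitrary, φ : ℝ/ℤ → ℝ continuous). Then for every x ∈ ℝ/ℤ the set 𝓛_x is a closed subsemigroup of ℝ: it is topologically closed, and if y₁ ∈ 𝓛_x and y₂ ∈ 𝓛_x then y₁ + y₂ ∈ 𝓛_x. -/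
open Filter Topology MeasureTheory

noncomputable section

theorem mem_limitSet_iff {α : ℝ} {φ : AddCircle (1 : ℝ) → ℝ} {z w : AddCircle (1 : ℝ) × ℝ} :
    w ∈ limitSet α φ z ↔
      ∀ U ∈ 𝓝 w, ∀ N : ℤ, ∃ n : ℤ, N ≤ |n| ∧ ((anzai α φ) ^ n) z ∈ U := by
  constructor
  · rintro ⟨n, hn, hw⟩ U hU N
    obtain ⟨k, hk⟩ := ((hn.eventually_ge_atTop N).and (hw.eventually_mem hU)).exists
    exact ⟨n k, hk⟩
  · intro h
    obtain ⟨U, hU⟩ := (𝓝 w).exists_antitone_basis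
    choose n hn hnU using fun k : ℕ => h (U k) (hU.mem k) k
    exact ⟨n, tendsto_atTop_mono hn tendsto_natCast_atTop_atTop, hU.tendsto hnU⟩

theorem isClosed_limitSet (α : ℝ) (φ : AddCircle (1 : ℝ) → ℝ) (z : AddCircle (1 : ℝ) × ℝ) :
    IsClosed (limitSet α φ z) := by
  refine isClosed_of_closure_subset fun w hw => mem_limitSet_iff.2 fun U hU N => ?_
  obtain ⟨V, hVU, hV, hwV⟩ := mem_nhds_iff.1 hU
  obtain ⟨v, hvV, hv⟩ := mem_closure_iff.1 hw V hV hwV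
  obtain ⟨n, hn, hnV⟩ := mem_limitSet_iff.1 hv V (hV.mem_nhds hvV) N
  exact ⟨n, hn, hVU hnV⟩

theorem continuous_anzai_zpow (α : ℝ) {φ : AddCircle (1 : ℝ) → ℝ} (hφ : Continuous φ) (n : ℤ) :
    Continuous ⇑((anzai α φ) ^ n) := by
  have hF : Continuous (anzai α φ) := by
    change Continuous fun z : AddCircle (1 : ℝ) × ℝ =>
      (z.1 + (α : AddCircle (1 : ℝ)), z.2 + φ z.1)
    fun_prop
  have hG : Continuous ⇑(anzai α φ)⁻¹ := by
    change Continuous fun z : AddCircle (1 : ℝ) × ℝ =>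
      (z.1 - (α : AddCircle (1 : ℝ)), z.2 - φ (z.1 - (α : AddCircle (1 : ℝ))))
    fun_prop
  obtain ⟨k, rfl | rfl⟩ := n.eq_nat_or_neg
  · rw [zpow_natCast, Equiv.Perm.coe_pow]
    exact hF.iterate k
  · rw [zpow_neg, zpow_natCast, ← inv_pow, Equiv.Perm.coe_pow]
    exact hG.iterate k

theorem limitSet_trans {α : ℝ} {φ : AddCircle (1 : ℝ) → ℝ} (hφ : Continuous φ)
    {z v w : AddCircle (1 : ℝ) × ℝ} (hv : v ∈ limitSet α φ z) (hw : w ∈ limitSet α φ v) :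
    w ∈ limitSet α φ z := by
  refine mem_limitSet_iff.2 fun U hU N => ?_
  obtain ⟨V, hVU, hV, hwV⟩ := mem_nhds_iff.1 hU
  obtain ⟨n, -, hnV⟩ := mem_limitSet_iff.1 hw V (hV.mem_nhds hwV) 0
  obtain ⟨m, hm, hmV⟩ := mem_limitSet_iff.1 hv _
    ((continuous_anzai_zpow α hφ n).continuousAt.preimage_mem_nhds (hV.mem_nhds hnV)) (N + |n|)
  refine ⟨n + m, by grind, hVU ?_⟩
  rwa [zpow_add]

/-- Translation by `c` in the fibre direction. -/
def verticalTranslation (c : ℝ) : Equiv.Perm (AddCircle (1 : ℝ) × ℝ) :=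
  (Equiv.refl _).prodCongr (Equiv.addRight c)

theorem commute_anzai_verticalTranslation (α : ℝ) (φ : AddCircle (1 : ℝ) → ℝ) (c : ℝ) :
    Commute (anzai α φ) (verticalTranslation c) := by
  ext z
  · rfl
  · exact add_right_comm z.2 c (φ z.1)

theorem verticalTranslation_mem_limitSet {α : ℝ} {φ : AddCircle (1 : ℝ) → ℝ}
    {z w : AddCircle (1 : ℝ) × ℝ} (c : ℝ) (hw : w ∈ limitSet α φ z) :
    verticalTranslation c w ∈ limitSet α φ (verticalTranslation c z) := by
  obtain ⟨n, hn, hlim⟩ := hw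
  have hT : Continuous (verticalTranslation c) := by
    change Continuous fun z : AddCircle (1 : ℝ) × ℝ => (z.1, z.2 + c)
    fun_prop
  refine ⟨n, hn, ((hT.tendsto w).comp hlim).congr fun k => ?_⟩
  exact (DFunLike.congr_fun
    ((commute_anzai_verticalTranslation α φ c).zpow_left (n k)).eq z).symm

/-- For every `x`, the set `𝓛_x` is a closed subsemigroup of `ℝ`. -/
theorem stmt_11 (α : ℝ) (φ : AddCircle (1 : ℝ) → ℝ) (hφcont : Continuous φ)
    (x : AddCircle (1 : ℝ)) :
    IsClosed (Lx α φ x) ∧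
      ∀ y₁ ∈ Lx α φ x, ∀ y₂ ∈ Lx α φ x, y₁ + y₂ ∈ Lx α φ x := by
  refine ⟨(isClosed_limitSet α φ (x, 0)).preimage (by fun_prop : Continuous fun y : ℝ => (x, y)),
    fun y₁ h₁ y₂ h₂ => limitSet_trans hφcont h₂ ?_⟩
  simpa [verticalTranslation] using verticalTranslation_mem_limitSet y₂ h₁
end
end

section
/- Let α be irrational, let (q_n)_{n≥1} be positive integers with ‖q_nα‖ < 1/q_n and q_{n+1} > 10 q_n for all n, and let φ(x) = Σ_{n=1}^∞ (2/n)(sin(2π q_n(x+α)) − sin(2π q_n x)). Then the cohomological equation has no continuous solution: there is no continuous function g : ℝ/ℤ → ℝ such that g(x+α) − g(x) = φ(x) for all x ∈ ℝ/ℤ. -/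
open Filter Topology MeasureTheory

noncomputable section

/-- The hypotheses on the sequence `(q_n)` (here indexed from `0`): each `q_n` is a positive
integer with `‖q_n α‖ < 1/q_n` and `q_{n+1} > 10 q_n`, where `‖·‖` is the distance to the
nearest integer. -/
def QSeq (α : ℝ) (q : ℕ → ℕ) : Prop :=
  ∀ n : ℕ, 0 < q n ∧
    ‖(((q n : ℝ) * α : ℝ) : AddCircle (1 : ℝ))‖ < 1 / (q n : ℝ) ∧
    10 * q n < q (n + 1)

/-- The `n`-th term `(2/n)(sin(2π q_n(x+α)) − sin(2π q_n x))` of the series defining `φ`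
(reindexed so that the index starts at `0`, with coefficient `2/(n+1)`). -/
def sinTerm (α : ℝ) (q : ℕ → ℕ) (n : ℕ) (x : ℝ) : ℝ :=
  (2 / ((n : ℝ) + 1)) *
    (Real.sin (2 * Real.pi * (q n : ℝ) * (x + α)) - Real.sin (2 * Real.pi * (q n : ℝ) * x))

/-- The sum `φ(x) = Σₙ (2/n)(sin(2π q_n(x+α)) − sin(2π q_n x))` of the series, as a
(1-periodic) function on `ℝ`. -/
def phiSum (α : ℝ) (q : ℕ → ℕ) (x : ℝ) : ℝ := ∑' n : ℕ, sinTerm α q n x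

/-- The character `x ↦ exp (2πi d x)` of the circle, as a 1-periodic function on `ℝ`. -/
def circleChar (d : ℤ) (x : ℝ) : ℂ := Complex.exp (2 * Real.pi * Complex.I * d * x)

/-- The `d`-th Fourier coefficient of a 1-periodic function. -/
def circleCoeff (f : ℝ → ℝ) (d : ℤ) : ℂ := ∫ t in (0 : ℝ)..1, (f t : ℂ) * circleChar (-d) t

lemma continuous_circleChar (d : ℤ) : Continuous (circleChar d) := by
  unfold circleChar
  fun_prop

lemma circleChar_zero (x : ℝ) : circleChar 0 x = 1 := by simp [circleChar]

lemma circleChar_add (d : ℤ) (x y : ℝ) :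
    circleChar d (x + y) = circleChar d x * circleChar d y := by
  simp only [circleChar, ← Complex.exp_add]
  congr 1
  push_cast
  ring

lemma circleChar_int_add (d e : ℤ) (x : ℝ) :
    circleChar (d + e) x = circleChar d x * circleChar e x := by
  simp only [circleChar, ← Complex.exp_add]
  congr 1
  push_cast
  ring

lemma circleChar_neg (d : ℤ) (x : ℝ) : circleChar d (-x) = circleChar (-d) x := by
  simp only [circleChar]
  congr 1
  push_cast
  ring

lemma circleChar_mul_neg (d : ℤ) (x : ℝ) : circleChar d x * circleChar (-d) x = 1 := by
  rw [← circleChar_int_add, add_neg_cancel, circleChar_zero]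

lemma conj_circleChar (d : ℤ) (x : ℝ) :
    (starRingEnd ℂ) (circleChar d x) = circleChar (-d) x := by
  simp only [circleChar, ← Complex.exp_conj]
  congr 1
  simp [Complex.conj_ofReal, Complex.conj_ofNat]

lemma circleChar_eq_exp_ofReal_mul_I (d : ℤ) (x : ℝ) :
    circleChar d x = Complex.exp ((2 * Real.pi * d * x : ℝ) * Complex.I) := by
  simp only [circleChar]
  congr 1
  push_cast
  ring

lemma norm_circleChar (d : ℤ) (x : ℝ) : ‖circleChar d x‖ = 1 := by
  rw [circleChar_eq_exp_ofReal_mul_I, Complex.norm_exp_ofReal_mul_I]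

lemma circleChar_im (d : ℤ) (x : ℝ) : (circleChar d x).im = Real.sin (2 * Real.pi * d * x) := by
  rw [circleChar_eq_exp_ofReal_mul_I, Complex.exp_ofReal_mul_I_im]

lemma circleChar_one (d : ℤ) : circleChar d 1 = 1 := by
  rw [circleChar, Complex.exp_eq_one_iff]
  exact ⟨d, by push_cast; ring⟩

lemma circleChar_periodic (d : ℤ) : Function.Periodic (circleChar d) 1 := fun x => by
  rw [circleChar_add, circleChar_one, mul_one]

lemma circleChar_ne_one {α : ℝ} (hα : Irrational α) {d : ℤ} (hd : d ≠ 0) :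
    circleChar d α ≠ 1 := by
  rw [circleChar, Ne, Complex.exp_eq_one_iff]
  rintro ⟨m, hm⟩
  have h2 : (2 * Real.pi * Complex.I : ℂ) ≠ 0 := Complex.two_pi_I_ne_zero
  have h3 : ((d : ℂ) * α) = m := by
    apply mul_left_cancel₀ h2
    linear_combination hm
  have h4 : (d : ℝ) * α = m := by exact_mod_cast h3
  exact (hα.intCast_mul hd).ne_int m h4

lemma integral_circleChar (d : ℤ) :
    ∫ t in (0 : ℝ)..1, circleChar d t = if d = 0 then 1 else 0 := by
  split_ifs with hd
  · simp [hd, circleChar_zero]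
  · have hc : (2 * Real.pi * Complex.I * d : ℂ) ≠ 0 :=
      mul_ne_zero Complex.two_pi_I_ne_zero (by exact_mod_cast hd)
    have h := circleChar_one d
    simp only [circleChar] at h ⊢
    rw [integral_exp_mul_complex hc, h]
    simp

lemma circleCoeff_const_one (d : ℤ) :
    circleCoeff (fun _ => 1) d = if d = 0 then 1 else 0 := by
  simp [circleCoeff, integral_circleChar]

lemma circleCoeff_comp_add {f : ℝ → ℝ} (hf : Function.Periodic f 1) (α : ℝ) (d : ℤ) :
    circleCoeff (fun t => f (t + α)) d = circleChar d α * circleCoeff f d := by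
  have hper : Function.Periodic (fun t => (f t : ℂ) * circleChar (-d) t) 1 := fun t => by
    simp only [hf t, circleChar_periodic (-d) t]
  have key : ∀ t, (f (t + α) : ℂ) * circleChar (-d) t =
      circleChar d α * ((f (t + α) : ℂ) * circleChar (-d) (t + α)) := fun t => by
    rw [circleChar_add]
    linear_combination (-(f (t + α) : ℂ) * circleChar (-d) t) * circleChar_mul_neg d α
  simp only [circleCoeff, key]
  rw [intervalIntegral.integral_const_mul,
    intervalIntegral.integral_comp_add_right (fun t => (f t : ℂ) * circleChar (-d) t)]
  congr 1
  have := hper.intervalIntegral_add_eq α 0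
  simpa [add_comm] using this

lemma circleCoeff_comp_add_sub {f : ℝ → ℝ} (hc : Continuous f) (hf : Function.Periodic f 1)
    (α : ℝ) (d : ℤ) :
    circleCoeff (fun t => f (t + α) - f t) d = (circleChar d α - 1) * circleCoeff f d := by
  have hE := continuous_circleChar (-d)
  rw [sub_mul, ← circleCoeff_comp_add hf, one_mul]
  simp only [circleCoeff, Complex.ofReal_sub, sub_mul]
  apply intervalIntegral.integral_sub <;> apply Continuous.intervalIntegrable <;> fun_prop

lemma circleCoeff_const_mul (c : ℝ) (f : ℝ → ℝ) (d : ℤ) :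
    circleCoeff (fun t => c * f t) d = c * circleCoeff f d := by
  simp only [circleCoeff, Complex.ofReal_mul, mul_assoc, intervalIntegral.integral_const_mul]

lemma circleCoeff_sin (m d : ℤ) :
    circleCoeff (fun t => Real.sin (2 * Real.pi * m * t)) d =
      ((if d = -m then 1 else 0) - (if d = m then 1 else 0)) * Complex.I / 2 := by
  have key : ∀ t : ℝ, ((Real.sin (2 * Real.pi * m * t) : ℝ) : ℂ) * circleChar (-d) t =
      (circleChar (-m + -d) t - circleChar (m + -d) t) * (Complex.I / 2) := fun t => by
    rw [circleChar_int_add, circleChar_int_add, Complex.ofReal_sin, Complex.sin]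
    have h1 : Complex.exp (-((2 * Real.pi * m * t : ℝ) : ℂ) * Complex.I) = circleChar (-m) t := by
      rw [circleChar]; congr 1; push_cast; ring
    have h2 : Complex.exp (((2 * Real.pi * m * t : ℝ) : ℂ) * Complex.I) = circleChar m t := by
      rw [circleChar]; congr 1; push_cast; ring
    rw [h1, h2]
    ring
  simp only [circleCoeff, key]
  rw [intervalIntegral.integral_mul_const, intervalIntegral.integral_sub
    ((continuous_circleChar _).intervalIntegrable _ _)
    ((continuous_circleChar _).intervalIntegrable _ _), integral_circleChar, integral_circleChar]
  have e1 : (-m + -d = 0) ↔ d = -m := by omega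
  have e2 : (m + -d = 0) ↔ d = m := by omega
  simp only [e1, e2]
  ring

lemma norm_circleCoeff_le {f : ℝ → ℝ} {B : ℝ} (hB : ∀ t, |f t| ≤ B) (d : ℤ) :
    ‖circleCoeff f d‖ ≤ B := by
  have := intervalIntegral.norm_integral_le_of_norm_le_const (a := (0 : ℝ)) (b := 1)
    (f := fun t => (f t : ℂ) * circleChar (-d) t) (C := B) (fun t _ => by
      simpa [norm_circleChar] using hB t)
  simpa [circleCoeff] using this

/-- The Fejér-type trigonometric polynomial `|∑_{j<M} e(jy)|²`. -/
def fejerSum (M : ℕ) (y : ℝ) : ℝ := Complex.normSq (∑ j ∈ Finset.range M, circleChar j y)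

lemma continuous_fejerSum (M : ℕ) : Continuous (fejerSum M) :=
  Complex.continuous_normSq.comp
    (continuous_finsetSum _ fun j _ => continuous_circleChar (j : ℤ))

lemma fejerSum_nonneg (M : ℕ) (y : ℝ) : 0 ≤ fejerSum M y := Complex.normSq_nonneg _

lemma fejerSum_eq (M : ℕ) (y : ℝ) :
    (fejerSum M y : ℂ) =
      ∑ j ∈ Finset.range M, ∑ k ∈ Finset.range M, circleChar ((j : ℤ) - k) y := by
  rw [fejerSum, ← Complex.mul_conj, map_sum, Finset.sum_mul_sum]
  simp only [conj_circleChar, sub_eq_add_neg, circleChar_int_add]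

lemma integral_mul_fejerSum {f : ℝ → ℝ} (hf : Continuous f) (M : ℕ) (x : ℝ) :
    ((∫ t in (0 : ℝ)..1, f t * fejerSum M (x - t) : ℝ) : ℂ) =
      ∑ j ∈ Finset.range M, ∑ k ∈ Finset.range M,
        circleChar ((j : ℤ) - k) x * circleCoeff f ((j : ℤ) - k) := by
  rw [← intervalIntegral.integral_ofReal]
  have key : ∀ t : ℝ, ((f t * fejerSum M (x - t) : ℝ) : ℂ) =
      ∑ j ∈ Finset.range M, ∑ k ∈ Finset.range M,
        circleChar ((j : ℤ) - k) x * ((f t : ℂ) * circleChar (-((j : ℤ) - k)) t) := fun t => by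
    rw [Complex.ofReal_mul, fejerSum_eq, Finset.mul_sum]
    refine Finset.sum_congr rfl fun j _ => ?_
    rw [Finset.mul_sum]
    refine Finset.sum_congr rfl fun k _ => ?_
    rw [sub_eq_add_neg x t, circleChar_add, circleChar_neg]
    ring
  have hcont : ∀ d : ℤ, Continuous fun t : ℝ =>
      circleChar d x * ((f t : ℂ) * circleChar (-d) t) := fun d => by
    have := continuous_circleChar (-d)
    fun_prop
  simp only [key]
  rw [intervalIntegral.integral_finsetSum fun j _ =>
    (continuous_finsetSum _ fun k _ => hcont _).intervalIntegrable _ _]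
  refine Finset.sum_congr rfl fun j _ => ?_
  rw [intervalIntegral.integral_finsetSum fun k _ => (hcont _).intervalIntegrable _ _]
  refine Finset.sum_congr rfl fun k _ => ?_
  rw [intervalIntegral.integral_const_mul, circleCoeff]

lemma integral_fejerSum (M : ℕ) (x : ℝ) : ∫ t in (0 : ℝ)..1, fejerSum M (x - t) = M := by
  have h := integral_mul_fejerSum (f := fun _ => 1) continuous_const M x
  simp only [one_mul, circleCoeff_const_one, sub_eq_zero, Nat.cast_inj] at h
  have h2 : ∀ j ∈ Finset.range M, (∑ k ∈ Finset.range M,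
      circleChar ((j : ℤ) - k) x * (if j = k then 1 else 0)) = 1 := fun j hj => by
    rw [Finset.sum_eq_single j]
    · simp [circleChar_zero]
    · intro k _ hk
      simp [hk.symm]
    · exact fun h => (h hj).elim
  rw [Finset.sum_congr rfl h2] at h
  simp only [Finset.sum_const, Finset.card_range, nsmul_eq_mul, mul_one] at h
  exact_mod_cast h

lemma sum_re_circleCoeff_le {f : ℝ → ℝ} (hf : Continuous f) {B : ℝ} (hB : ∀ t, |f t| ≤ B)
    (M : ℕ) (x : ℝ) :
    ∑ j ∈ Finset.range M, ∑ k ∈ Finset.range M,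
      (circleChar ((j : ℤ) - k) x * circleCoeff f ((j : ℤ) - k)).re ≤ B * M := by
  have h := congrArg Complex.re (integral_mul_fejerSum hf M x)
  simp only [Complex.re_sum, Complex.ofReal_re] at h
  rw [← h, ← integral_fejerSum M x, ← intervalIntegral.integral_const_mul]
  have hF := continuous_fejerSum M
  refine intervalIntegral.integral_mono_on zero_le_one
    (Continuous.intervalIntegrable (by fun_prop) _ _)
    (Continuous.intervalIntegrable (by fun_prop) _ _) fun t _ => ?_
  exact mul_le_mul_of_nonneg_right ((le_abs_self _).trans (hB t)) (fejerSum_nonneg _ _)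

namespace QSeq

variable {α : ℝ} {q : ℕ → ℕ}

lemma strictMono (hq : QSeq α q) : StrictMono q :=
  strictMono_nat_of_lt_succ fun n => by
    have := hq n
    omega

lemma ten_pow_le (hq : QSeq α q) (n : ℕ) : 10 ^ n ≤ q n := by
  induction n with
  | zero => exact (hq 0).1
  | succ n ih =>
    have := (hq n).2.2
    rw [pow_succ]
    omega

lemma norm_sinTerm_le (hq : QSeq α q) (n : ℕ) (x : ℝ) :
    ‖sinTerm α q n x‖ ≤ 4 * Real.pi * (1 / 10) ^ n := by
  obtain ⟨hpos, hnorm, -⟩ := hq n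
  rw [AddCircle.norm_eq] at hnorm
  simp only [inv_one, one_mul, mul_one] at hnorm
  set m : ℤ := round ((q n : ℝ) * α)
  have hs : Real.sin (2 * Real.pi * (q n : ℝ) * (x + α)) =
      Real.sin (2 * Real.pi * (q n : ℝ) * x + 2 * Real.pi * ((q n : ℝ) * α - m)) := by
    rw [← Real.sin_sub_int_mul_two_pi _ m]
    congr 1
    ring
  have hlip : ∀ a b : ℝ, |Real.sin (a + b) - Real.sin a| ≤ |b| := fun a b => by
    have := Real.lipschitzWith_sin.dist_le_mul (a + b) a
    simpa [Real.dist_eq] using this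
  have h1 := hlip (2 * Real.pi * (q n : ℝ) * x) (2 * Real.pi * ((q n : ℝ) * α - m))
  rw [abs_mul, abs_of_pos Real.two_pi_pos] at h1
  have hq' : 1 / (q n : ℝ) ≤ (1 / 10) ^ n := by
    rw [one_div_pow]
    exact one_div_le_one_div_of_le (by positivity) (by exact_mod_cast hq.ten_pow_le n)
  have h2 : (2 : ℝ) / ((n : ℝ) + 1) ≤ 2 := by
    rw [div_le_iff₀ (by positivity)]
    nlinarith [(Nat.cast_nonneg n : (0 : ℝ) ≤ n)]
  rw [sinTerm, hs, Real.norm_eq_abs, abs_mul, abs_of_nonneg (by positivity : (0 : ℝ) ≤ 2 / (n + 1))]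
  calc _ ≤ 2 * (2 * Real.pi * (1 / 10) ^ n) := by
        refine mul_le_mul h2 (h1.trans ?_) (abs_nonneg _) zero_le_two
        exact mul_le_mul_of_nonneg_left (hnorm.le.trans hq') Real.two_pi_pos.le
    _ = _ := by ring

lemma circleCoeff_sinTerm (α : ℝ) (q : ℕ → ℕ) (n : ℕ) (d : ℤ) :
    circleCoeff (sinTerm α q n) d = (circleChar d α - 1) * ((2 / ((n : ℝ) + 1) : ℝ) *
      circleCoeff (fun t => Real.sin (2 * Real.pi * (q n : ℤ) * t)) d) := by
  have hper : Function.Periodic (fun t : ℝ => Real.sin (2 * Real.pi * (q n : ℤ) * t)) 1 :=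
    fun t => by
      beta_reduce
      rw [← circleChar_im, ← circleChar_im, circleChar_periodic]
  have h := circleCoeff_comp_add_sub (by fun_prop) hper α d
  rw [mul_left_comm, ← h, ← circleCoeff_const_mul]
  simp only [Int.cast_natCast]
  rfl

lemma hasSum_circleCoeff_phiSum (hq : QSeq α q) (d : ℤ) :
    HasSum (fun n => circleCoeff (sinTerm α q n) d) (circleCoeff (phiSum α q) d) := by
  have hgeo : Summable fun n : ℕ => 4 * Real.pi * (1 / 10 : ℝ) ^ n :=
    (summable_geometric_of_lt_one (by norm_num) (by norm_num)).mul_left _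
  refine intervalIntegral.hasSum_integral_of_dominated_convergence
    (fun n _ => 4 * Real.pi * (1 / 10 : ℝ) ^ n) (fun n => ?_) (fun n => ?_) ?_ ?_ ?_
  · apply Continuous.aestronglyMeasurable
    have := continuous_circleChar (-d)
    unfold sinTerm
    fun_prop
  · refine Eventually.of_forall fun t _ => ?_
    rw [norm_mul, norm_circleChar, mul_one, Complex.norm_real]
    exact hq.norm_sinTerm_le n t
  · exact Eventually.of_forall fun t _ => hgeo
  · exact intervalIntegrable_const
  · refine Eventually.of_forall fun t _ => HasSum.mul_right _ ?_
    exact Complex.hasSum_ofReal.2 (hgeo.of_norm_bounded fun n => hq.norm_sinTerm_le n t).hasSum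

lemma hasSum_circleCoeff_solution (hα : Irrational α) (hq : QSeq α q) {g : ℝ → ℝ}
    (hg : Continuous g) (hper : Function.Periodic g 1)
    (h : ∀ x, g (x + α) - g x = phiSum α q x) {d : ℤ} (hd : d ≠ 0) :
    HasSum (fun n : ℕ => ((2 / ((n : ℝ) + 1) : ℝ) : ℂ) *
      circleCoeff (fun t => Real.sin (2 * Real.pi * (q n : ℤ) * t)) d) (circleCoeff g d) := by
  have hne : circleChar d α - 1 ≠ 0 := sub_ne_zero.2 (circleChar_ne_one hα hd)
  have hs := hq.hasSum_circleCoeff_phiSum d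
  rw [← funext h, circleCoeff_comp_add_sub hg hper] at hs
  simp only [circleCoeff_sinTerm] at hs
  exact (hasSum_mul_left_iff hne).1 hs

lemma re_circleChar_mul_circleCoeff_sin (m : ℕ) (hm : 0 < m) (d : ℤ) (x : ℝ) :
    (circleChar d x * circleCoeff (fun t => Real.sin (2 * Real.pi * (m : ℤ) * t)) d).re =
      if d = m ∨ d = -m then Real.sin (2 * Real.pi * m * x) / 2 else 0 := by
  rw [circleCoeff_sin]
  by_cases h1 : d = m
  · simp only [h1, if_true, true_or]
    rw [if_neg (by omega)]
    simp [Complex.mul_re, circleChar_im]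
    ring
  · by_cases h2 : d = -m
    · simp only [h2, or_true, if_true]
      rw [if_neg (by omega)]
      simp [Complex.mul_re, circleChar_im]
      ring
    · simp [h1, h2]

lemma sum_le_re_circleCoeff_solution (hα : Irrational α) (hq : QSeq α q) {g : ℝ → ℝ}
    (hg : Continuous g) (hper : Function.Periodic g 1)
    (h : ∀ x, g (x + α) - g x = phiSum α q x) {d : ℤ} (hd : d ≠ 0) {x : ℝ} {N : ℕ}
    (hx : ∀ n, 1 / 2 ≤ Real.sin (2 * Real.pi * q n * x)) :
    ∑ n ∈ Finset.range N, (if d = q n then 1 / (2 * ((n : ℝ) + 1)) else 0) ≤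
      (circleChar d x * circleCoeff g d).re := by
  have hs := Complex.hasSum_re
    ((hq.hasSum_circleCoeff_solution hα hg hper h hd).mul_left (circleChar d x))
  have hterm : ∀ n : ℕ, (circleChar d x * (((2 / ((n : ℝ) + 1) : ℝ) : ℂ) *
      circleCoeff (fun t => Real.sin (2 * Real.pi * (q n : ℤ) * t)) d)).re =
      2 / ((n : ℝ) + 1) *
        (if d = q n ∨ d = -q n then Real.sin (2 * Real.pi * q n * x) / 2 else 0) := fun n => by
    rw [mul_left_comm, Complex.re_ofReal_mul, re_circleChar_mul_circleCoeff_sin _ (hq n).1]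
  simp only [hterm] at hs
  refine le_trans (Finset.sum_le_sum fun n _ => ?_) (sum_le_hasSum (Finset.range N) ?_ hs)
  · have hxn := hx n
    by_cases h1 : d = q n
    · simp only [h1, if_true, true_or]
      rw [div_mul_eq_mul_div, div_le_div_iff₀ (by positivity) (by positivity)]
      nlinarith [(Nat.cast_nonneg n : (0 : ℝ) ≤ n)]
    · rw [if_neg h1]
      split_ifs
      · have : 0 ≤ Real.sin (2 * Real.pi * q n * x) := by linarith
        positivity
      · simp
  · intro n _
    have : 0 ≤ Real.sin (2 * Real.pi * q n * x) := by linarith [hx n]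
    split_ifs <;> positivity

end QSeq

/-- Integers `m_n` for which the intervals `[(m_n + 1/12) / q_n, (m_n + 5/12) / q_n]` are nested
as soon as `q_{n+1} ≥ 10 q_n`. -/
def nestedIndex (q : ℕ → ℕ) : ℕ → ℤ
  | 0 => 0
  | n + 1 => ⌈(q (n + 1) : ℝ) * ((nestedIndex q n + 1 / 12) / q n) - 1 / 12⌉

lemma half_le_sin_of_mem {m : ℤ} {y : ℝ} (h1 : m + 1 / 12 ≤ y) (h2 : y ≤ m + 5 / 12) :
    1 / 2 ≤ Real.sin (2 * Real.pi * y) := by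
  have hpi := Real.pi_pos
  have hs : Real.sin (2 * Real.pi * y) =
      Real.cos (|2 * Real.pi * (y - m) - Real.pi / 2|) := by
    rw [Real.cos_abs, Real.cos_sub_pi_div_two, ← Real.sin_sub_int_mul_two_pi _ m]
    congr 1
    ring
  rw [hs, ← Real.cos_pi_div_three]
  refine Real.cos_le_cos_of_nonneg_of_le_pi (abs_nonneg _) (by linarith) (abs_le.2 ⟨?_, ?_⟩) <;>
    nlinarith

lemma QSeq.exists_forall_half_le_sin {α : ℝ} {q : ℕ → ℕ} (hq : QSeq α q) :
    ∃ x : ℝ, ∀ n, 1 / 2 ≤ Real.sin (2 * Real.pi * q n * x) := by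
  have hpos : ∀ n, (0 : ℝ) < q n := fun n => by exact_mod_cast (hq n).1
  set a : ℕ → ℝ := fun n => (nestedIndex q n + 1 / 12) / q n with ha
  set b : ℕ → ℝ := fun n => (nestedIndex q n + 5 / 12) / q n with hb
  have hamono : Monotone a := monotone_nat_of_le_succ fun n => by
    have h1 := Int.le_ceil ((q (n + 1) : ℝ) * a n - 1 / 12)
    change a n ≤ (nestedIndex q (n + 1) + 1 / 12) / q (n + 1)
    rw [le_div_iff₀ (hpos _), nestedIndex]
    linarith
  have hbanti : Antitone b := antitone_nat_of_succ_le fun n => by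
    have h1 := Int.ceil_lt_add_one ((q (n + 1) : ℝ) * a n - 1 / 12)
    have hq10 : 10 * (q n : ℝ) ≤ q (n + 1) := by exact_mod_cast (hq n).2.2.le
    have h2 : b n = a n + 1 / (3 * q n) := by
      simp only [ha, hb]
      have := (hpos n).ne'
      field_simp
      ring
    have h3 : 10 / 3 ≤ (q (n + 1) : ℝ) * (1 / (3 * q n)) := by
      rw [mul_one_div, div_le_div_iff₀ (by norm_num) (by linarith [hpos n])]
      linarith
    change (nestedIndex q (n + 1) + 5 / 12) / q (n + 1) ≤ b n
    rw [div_le_iff₀ (hpos _), nestedIndex, h2]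
    linarith
  have hab : ∀ n, a n ≤ b n := fun n => by
    simp only [ha, hb]
    gcongr
    norm_num
  refine ⟨⨆ n, a n, fun n => ?_⟩
  obtain ⟨h1, h2⟩ := Set.mem_iInter.1 (hamono.ciSup_mem_iInter_Icc_of_antitone hbanti hab) n
  rw [mul_assoc]
  rw [div_le_iff₀ (hpos n)] at h1
  rw [le_div_iff₀ (hpos n)] at h2
  exact half_le_sin_of_mem (m := nestedIndex q n) (by linarith) (by linarith)

lemma exists_abs_le_of_periodic {g : ℝ → ℝ} (hg : Continuous g) (hper : Function.Periodic g 1) :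
    ∃ B, ∀ t, |g t| ≤ B := by
  obtain ⟨B, hB⟩ := (hper.isBounded_of_continuous one_ne_zero hg).exists_norm_le
  exact ⟨B, fun t => hB _ (Set.mem_range_self t)⟩

lemma mul_le_sum_ite_sub_eq {Q m : ℕ} (hm : m ≤ Q) (c : ℝ) (hc : 0 ≤ c) :
    Q * c ≤ ∑ j ∈ Finset.range (2 * Q), ∑ k ∈ Finset.range (2 * Q),
      (if (j : ℤ) - k = m then c else 0) := by
  rw [Finset.sum_comm]
  have hsub : Finset.range Q ⊆ Finset.range (2 * Q) := Finset.range_subset_range.2 (by omega)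
  have hnn : ∀ j k : ℕ, 0 ≤ (if (j : ℤ) - k = m then c else 0) := fun j k => by
    split_ifs <;> simp [hc]
  calc (Q : ℝ) * c = ∑ k ∈ Finset.range Q, c := by simp
    _ ≤ ∑ k ∈ Finset.range Q, ∑ j ∈ Finset.range (2 * Q),
        (if (j : ℤ) - k = m then c else 0) := by
      refine Finset.sum_le_sum fun k hk => ?_
      rw [Finset.mem_range] at hk
      refine le_trans ?_ (Finset.single_le_sum (fun j _ => hnn j k)
        (Finset.mem_range.2 (by omega : k + m < 2 * Q)))
      simp
    _ ≤ _ := Finset.sum_le_sum_of_subset_of_nonneg hsub fun k _ _ =>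
      Finset.sum_nonneg fun j _ => hnn j k

lemma QSeq.sum_one_div_le {α : ℝ} (hα : Irrational α) {q : ℕ → ℕ} (hq : QSeq α q) {g : ℝ → ℝ}
    (hg : Continuous g) (hper : Function.Periodic g 1)
    (h : ∀ x, g (x + α) - g x = phiSum α q x) {B : ℝ} (hB : ∀ t, |g t| ≤ B) (N : ℕ) :
    ∑ n ∈ Finset.range N, 1 / ((n : ℝ) + 1) ≤ 8 * B := by
  obtain ⟨x, hx⟩ := hq.exists_forall_half_le_sin
  set Q := q N
  have hQ : (0 : ℝ) < Q := by exact_mod_cast (hq N).1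
  have hlow : ∀ j k : ℕ, (∑ n ∈ Finset.range N,
      (if (j : ℤ) - k = q n then 1 / (2 * ((n : ℝ) + 1)) else 0)) - (if j = k then B else 0) ≤
      (circleChar ((j : ℤ) - k) x * circleCoeff g ((j : ℤ) - k)).re := fun j k => by
    by_cases hjk : j = k
    · have hzero : ∑ n ∈ Finset.range N,
          (if (j : ℤ) - k = q n then 1 / (2 * ((n : ℝ) + 1)) else 0) = 0 :=
        Finset.sum_eq_zero fun n _ => if_neg (by have := (hq n).1; omega)
      rw [hzero, if_pos hjk, zero_sub]
      refine (abs_le.1 ((Complex.abs_re_le_norm _).trans ?_)).1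
      rw [norm_mul, norm_circleChar, one_mul]
      exact norm_circleCoeff_le hB _
    · rw [if_neg hjk, sub_zero]
      exact hq.sum_le_re_circleCoeff_solution hα hg hper h (by omega) hx
  have hdiag : ∑ j ∈ Finset.range (2 * Q), ∑ k ∈ Finset.range (2 * Q),
      (if j = k then B else 0) = 2 * Q * B := by
    simp +contextual [Finset.sum_ite_eq]
  have hpairs : ∑ n ∈ Finset.range N, Q * (1 / (2 * ((n : ℝ) + 1))) ≤
      ∑ j ∈ Finset.range (2 * Q), ∑ k ∈ Finset.range (2 * Q), ∑ n ∈ Finset.range N,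
        (if (j : ℤ) - k = q n then 1 / (2 * ((n : ℝ) + 1)) else 0) := by
    have hcomm : ∀ j : ℕ, ∑ k ∈ Finset.range (2 * Q), ∑ n ∈ Finset.range N,
        (if (j : ℤ) - k = q n then 1 / (2 * ((n : ℝ) + 1)) else 0) =
        ∑ n ∈ Finset.range N, ∑ k ∈ Finset.range (2 * Q),
        (if (j : ℤ) - k = q n then 1 / (2 * ((n : ℝ) + 1)) else 0) := fun j => Finset.sum_comm
    simp only [hcomm]
    rw [Finset.sum_comm]
    exact Finset.sum_le_sum fun n hn => mul_le_sum_ite_sub_eq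
      (hq.strictMono.monotone (Finset.mem_range.1 hn).le) _ (by positivity)
  have hall := (Finset.sum_le_sum fun j (_ : j ∈ Finset.range (2 * Q)) =>
    Finset.sum_le_sum fun k (_ : k ∈ Finset.range (2 * Q)) => hlow j k).trans
      (sum_re_circleCoeff_le hg hB (2 * Q) x)
  simp only [Finset.sum_sub_distrib] at hall
  rw [hdiag] at hall
  have hhalf : ∑ n ∈ Finset.range N, Q * (1 / (2 * ((n : ℝ) + 1))) =
      Q * ((∑ n ∈ Finset.range N, 1 / ((n : ℝ) + 1)) / 2) := by
    rw [← Finset.mul_sum, Finset.sum_div]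
    congr 1
    refine Finset.sum_congr rfl fun n _ => ?_
    rw [div_div, mul_comm]
  rw [hhalf] at hpairs
  push_cast at hall
  refine le_of_mul_le_mul_left (a := (Q : ℝ)) ?_ hQ
  linarith

/-- The cohomological equation `g(x+α) − g(x) = φ(x)` has no continuous 1-periodic
solution. -/
theorem stmt_15 (α : ℝ) (hα : Irrational α) (q : ℕ → ℕ) (hq : QSeq α q) :
    ¬ ∃ g : ℝ → ℝ, Continuous g ∧ (∀ x, g (x + 1) = g x) ∧
      ∀ x : ℝ, g (x + α) - g x = phiSum α q x := by
  rintro ⟨g, hg, hper, h⟩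
  obtain ⟨B, hB⟩ := exists_abs_le_of_periodic hg hper
  obtain ⟨N, hN⟩ :=
    (Real.tendsto_sum_range_one_div_nat_succ_atTop.eventually_gt_atTop (8 * B)).exists
  exact absurd (hq.sum_one_div_le hα hg hper h hB N) (not_le.2 hN)
end
end

section
/- Let (q_n)_{n≥1} be a sequence of positive integers with q_{n+1} > 10 q_n for all n. Then there exists a real number x₀ such that sin(2π q_n x₀) ≥ 1/2 for every n ≥ 1. (Equivalently, the intersection of the nested family of sets C_n = { x ∈ ℝ/ℤ : sin(2π q_n x) ≥ 1/2 } is nonempty: each connected component of C_n contains a connected component of C_{n+1}.) -/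
/-- The `k`-th closed arc (lifted to `ℝ`) of the set where `sin (2π q x) ≥ 1/2`. -/
def sineArc (q : ℕ) (k : ℤ) : Set ℝ :=
  Set.Icc (((k : ℝ) + 1 / 12) / q) (((k : ℝ) + 5 / 12) / q)

theorem sineArc_nonempty (q : ℕ) (k : ℤ) : (sineArc q k).Nonempty :=
  Set.nonempty_Icc.2 (by gcongr; norm_num)

theorem half_le_sin_of_mem_sineArc {q : ℕ} (hq : 0 < q) {k : ℤ} {x : ℝ} (hx : x ∈ sineArc q k) :
    1 / 2 ≤ Real.sin (2 * Real.pi * (q : ℝ) * x) := by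
  have hq' : (0 : ℝ) < q := by exact_mod_cast hq
  obtain ⟨hlow, hupp⟩ := hx
  rw [div_le_iff₀ hq'] at hlow
  rw [le_div_iff₀ hq'] at hupp
  have hpi := Real.pi_pos
  have hcos : Real.cos (2 * Real.pi * (x * q - k - 1 / 4)) =
      Real.sin (2 * Real.pi * (q : ℝ) * x) := by
    rw [← Real.cos_sub_pi_div_two,
      ← Real.cos_sub_int_mul_two_pi (2 * Real.pi * q * x - Real.pi / 2) k]
    ring_nf
  rw [← hcos, ← Real.cos_pi_div_three, ← Real.cos_abs (2 * Real.pi * _)]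
  apply Real.cos_le_cos_of_nonneg_of_le_pi (abs_nonneg _) (by linarith)
  rw [abs_le]
  constructor <;> nlinarith

theorem exists_sineArc_subset {q r : ℕ} (hq : 0 < q) (hr : 10 * q < r) (k : ℤ) :
    ∃ l : ℤ, sineArc r l ⊆ sineArc q k := by
  have hq' : (0 : ℝ) < q := by exact_mod_cast hq
  have hr' : (10 : ℝ) * q < r := by exact_mod_cast hr
  have hr0 : (0 : ℝ) < r := by linarith
  have hratio : (10 : ℝ) < r / q := by rwa [lt_div_iff₀ hq']
  refine ⟨⌈((k : ℝ) + 1 / 12) * (r / q) - 1 / 12⌉, Set.Icc_subset_Icc ?_ ?_⟩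
  · rw [le_div_iff₀ hr0, div_mul_eq_mul_div, mul_div_assoc]
    linarith [Int.le_ceil (((k : ℝ) + 1 / 12) * (r / q) - 1 / 12)]
  · rw [div_le_iff₀ hr0, div_mul_eq_mul_div, mul_div_assoc]
    linarith [Int.ceil_lt_add_one (((k : ℝ) + 1 / 12) * (r / q) - 1 / 12)]

/-- If `q_{n+1} > 10 q_n` for a sequence of positive integers, then there is a point `x₀`
with `sin(2π q_n x₀) ≥ 1/2` for all `n`. -/
theorem stmt_16 (q : ℕ → ℕ) (hpos : ∀ n, 0 < q n) (hgrow : ∀ n, 10 * q n < q (n + 1)) :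
    ∃ x₀ : ℝ, ∀ n : ℕ, 1 / 2 ≤ Real.sin (2 * Real.pi * (q n : ℝ) * x₀) := by
  choose next hnext using fun n => exists_sineArc_subset (hpos n) (hgrow n)
  let k : ℕ → ℤ := fun n => Nat.rec 0 next n
  obtain ⟨x, hx⟩ := IsCompact.nonempty_iInter_of_sequence_nonempty_isCompact_isClosed
    (fun n => sineArc (q n) (k n)) (fun n => hnext n (k n)) (fun n => sineArc_nonempty _ _)
    isCompact_Icc (fun n => isClosed_Icc)
  exact ⟨x, fun n => half_le_sin_of_mem_sineArc (hpos n) (Set.mem_iInter.1 hx n)⟩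
end

section
/- Let α ∈ ℝ and let φ : ℝ/ℤ → ℝ be continuous and satisfy the symmetry φ(−x−α) = φ(x) for all x ∈ ℝ/ℤ. Let F = F_{α,φ} be the associated Anzai skew product and let J : (ℝ/ℤ)×ℝ → (ℝ/ℤ)×ℝ be the involution J(x,y) = (−x,−y). Then J ∘ F ∘ J = F⁻¹, and consequently 𝓛_{−x} = −𝓛_x for every x ∈ ℝ/ℤ; in particular x ∈ P if and only if −x ∈ N, i.e. −P = N. -/
open Filter Topology MeasureTheory

noncomputable section

/-- The involution `J(x,y) = (−x,−y)`. -/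
def Jmap : AddCircle (1 : ℝ) × ℝ → AddCircle (1 : ℝ) × ℝ := fun z => (-z.1, -z.2)

/-- Under the symmetry `φ(−x−α) = φ(x)`, the involution `J` conjugates `F` to `F⁻¹`. -/
theorem Jmap_anzai_Jmap {α : ℝ} {φ : AddCircle (1 : ℝ) → ℝ}
    (hsym : ∀ x : AddCircle (1 : ℝ), φ (-x - (α : AddCircle (1 : ℝ))) = φ x)
    (z : AddCircle (1 : ℝ) × ℝ) : Jmap (anzai α φ (Jmap z)) = (anzai α φ)⁻¹ z := by
  have h : φ (-z.1) = φ (z.1 - (α : AddCircle (1 : ℝ))) := by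
    rw [← hsym (z.1 - (α : AddCircle (1 : ℝ)))]
    congr 1
    abel
  change (-(-z.1 + (α : AddCircle (1 : ℝ))), -(-z.2 + φ (-z.1))) =
    (z.1 - (α : AddCircle (1 : ℝ)), z.2 - φ (z.1 - (α : AddCircle (1 : ℝ))))
  rw [h]
  ext1
  · dsimp only
    abel
  · dsimp only
    ring

theorem Jmap_involutive : Function.Involutive Jmap := fun z => by simp [Jmap]

theorem continuous_Jmap : Continuous Jmap := by
  unfold Jmap
  fun_prop

theorem anzai_zpow_neg_Jmap {α : ℝ} {φ : AddCircle (1 : ℝ) → ℝ}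
    (hsym : ∀ x : AddCircle (1 : ℝ), φ (-x - (α : AddCircle (1 : ℝ))) = φ x)
    (n : ℤ) (z : AddCircle (1 : ℝ) × ℝ) :
    (anzai α φ ^ (-n)) (Jmap z) = Jmap ((anzai α φ ^ n) z) := by
  have h : SemiconjBy (Jmap_involutive.toPerm Jmap) (anzai α φ) (anzai α φ)⁻¹ := by
    ext1 w
    change Jmap (anzai α φ w) = (anzai α φ)⁻¹ (Jmap w)
    rw [← Jmap_anzai_Jmap hsym, Jmap_involutive]
  have hn := DFunLike.congr_fun (h.zpow_right n).eq z
  rw [inv_zpow'] at hn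
  exact hn.symm

theorem Jmap_mem_limitSet {α : ℝ} {φ : AddCircle (1 : ℝ) → ℝ}
    (hsym : ∀ x : AddCircle (1 : ℝ), φ (-x - (α : AddCircle (1 : ℝ))) = φ x)
    {z w : AddCircle (1 : ℝ) × ℝ} (hw : w ∈ limitSet α φ z) :
    Jmap w ∈ limitSet α φ (Jmap z) := by
  obtain ⟨n, hn, hlim⟩ := hw
  refine ⟨fun k => -n k, by simpa only [abs_neg] using hn, ?_⟩
  simp only [anzai_zpow_neg_Jmap hsym]
  exact (continuous_Jmap.tendsto w).comp hlim

theorem neg_mem_Lx_neg {α : ℝ} {φ : AddCircle (1 : ℝ) → ℝ}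
    (hsym : ∀ x : AddCircle (1 : ℝ), φ (-x - (α : AddCircle (1 : ℝ))) = φ x)
    {x : AddCircle (1 : ℝ)} {y : ℝ} (hy : y ∈ Lx α φ x) : -y ∈ Lx α φ (-x) := by
  simpa only [Lx, Jmap, neg_zero, Set.mem_ofPred_eq] using Jmap_mem_limitSet hsym hy

theorem Lx_neg {α : ℝ} {φ : AddCircle (1 : ℝ) → ℝ}
    (hsym : ∀ x : AddCircle (1 : ℝ), φ (-x - (α : AddCircle (1 : ℝ))) = φ x)
    (x : AddCircle (1 : ℝ)) : Lx α φ (-x) = {y : ℝ | -y ∈ Lx α φ x} := by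
  ext y
  refine ⟨fun hy => ?_, fun hy => ?_⟩
  · simpa only [neg_neg, Set.mem_ofPred_eq] using neg_mem_Lx_neg hsym hy
  · simpa only [neg_neg] using neg_mem_Lx_neg hsym hy

/-- If `φ(−x−α) = φ(x)`, then `J ∘ F ∘ J = F⁻¹`, hence `𝓛_{−x} = −𝓛_x` and `−P = N`. -/
theorem stmt_18 (α : ℝ) (φ : AddCircle (1 : ℝ) → ℝ) (hφcont : Continuous φ)
    (hsym : ∀ x : AddCircle (1 : ℝ), φ (-x - (α : AddCircle (1 : ℝ))) = φ x) :
    (∀ z : AddCircle (1 : ℝ) × ℝ, Jmap ((anzai α φ) (Jmap z)) = (anzai α φ)⁻¹ z) ∧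
    (∀ x : AddCircle (1 : ℝ), Lx α φ (-x) = {y : ℝ | -y ∈ Lx α φ x}) ∧
    (∀ x : AddCircle (1 : ℝ), Lx α φ x = Set.Ici 0 ↔ Lx α φ (-x) = Set.Iic 0) := by
  refine ⟨Jmap_anzai_Jmap hsym, Lx_neg hsym, fun x => ⟨fun h => ?_, fun h => ?_⟩⟩
  · rw [Lx_neg hsym, h]
    ext y
    simp
  · rw [← neg_neg x, Lx_neg hsym, h]
    ext y
    simp
end
end
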